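/- arXiv:1407.3523 — 4 statements merged into one kernel-verified Lean document; each statement's English description precedes it below -/
import Mathlib

section
/- Let n ≥ 1, β ∈ ℂ, and let L, U be real n×n matrices with L i j ≤ U i j entrywise. Let P be a complex n×n Hermitian matrix and let z ∈ ℂⁿ be a fixed vector. Then there exists a vertex matrix V ∈ 𝒱 such that for every A ∈ 𝒜, Re(star z ⬝ᵥ (M(P, A)).mulVec z) ≤ Re(star z ⬝ᵥ (M(P, V)).mulVec z); that is, for each fixed z the quadratic form A ↦ z* M(P, A) z is maximized over the interval matrix set at one of the vertex matrices. -/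
open Matrix

/-- `M(P, A) := β • (P * A) + (conj β) • (Aᵀ * P)`, with the real matrix `A`
coerced entrywise to `ℂ`. -/
noncomputable def Mmat {n : ℕ} (β : ℂ) (P : Matrix (Fin n) (Fin n) ℂ)
    (A : Matrix (Fin n) (Fin n) ℝ) : Matrix (Fin n) (Fin n) ℂ :=
  β • (P * A.map Complex.ofReal) + (starRingEnd ℂ β) • ((A.map Complex.ofReal)ᵀ * P)

/-- A linear functional on real matrices is maximized over the entrywise interval between `L` and
`U` at a matrix each of whose entries is that of `L` or that of `U`. -/
theorem exists_vertex_forall_le {m n : Type*} [Fintype m] [Fintype n]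
    (f : Matrix m n ℝ →ₗ[ℝ] ℝ) (L U : Matrix m n ℝ) :
    ∃ V : Matrix m n ℝ, (∀ i j, V i j = L i j ∨ V i j = U i j) ∧
      ∀ A : Matrix m n ℝ, (∀ i j, L i j ≤ A i j ∧ A i j ≤ U i j) → f A ≤ f V := by
  classical
  have hf : ∀ A, f A = ∑ i, ∑ j, A i j * f (Matrix.single i j 1) := by
    intro A
    conv_lhs => rw [Matrix.matrix_eq_sum_single A]
    simp only [map_sum]
    refine Finset.sum_congr rfl fun i _ => Finset.sum_congr rfl fun j _ => ?_
    rw [← smul_eq_mul, ← map_smul, Matrix.smul_single, smul_eq_mul, mul_one]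
  refine ⟨Matrix.of fun i j => if 0 ≤ f (Matrix.single i j 1) then U i j else L i j, fun i j => ?_,
    fun A hA => ?_⟩
  · rw [Matrix.of_apply]
    split_ifs <;> simp
  · rw [hf A, hf (Matrix.of _)]
    refine Finset.sum_le_sum fun i _ => Finset.sum_le_sum fun j _ => ?_
    rw [Matrix.of_apply]
    split_ifs with h
    · exact mul_le_mul_of_nonneg_right (hA i j).2 h
    · exact mul_le_mul_of_nonpos_right (hA i j).1 (not_le.mp h).le

theorem Mmat_add {n : ℕ} (β : ℂ) (P : Matrix (Fin n) (Fin n) ℂ)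
    (A B : Matrix (Fin n) (Fin n) ℝ) : Mmat β P (A + B) = Mmat β P A + Mmat β P B := by
  have h : (A + B).map Complex.ofReal = A.map Complex.ofReal + B.map Complex.ofReal := by
    ext; simp
  simp only [Mmat, h, Matrix.transpose_add, mul_add, add_mul, smul_add]
  abel

theorem Mmat_smul {n : ℕ} (β : ℂ) (P : Matrix (Fin n) (Fin n) ℂ)
    (c : ℝ) (A : Matrix (Fin n) (Fin n) ℝ) : Mmat β P (c • A) = (c : ℂ) • Mmat β P A := by
  have h : (c • A).map Complex.ofReal = (c : ℂ) • A.map Complex.ofReal := by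
    ext; simp
  simp only [Mmat, h, Matrix.transpose_smul, Matrix.mul_smul, Matrix.smul_mul, smul_add,
    smul_comm _ (c : ℂ)]

/-- The real part of the form `z* M(P, A) z`, as a real linear functional of `A`. -/
noncomputable def reFormMmat {n : ℕ} (β : ℂ) (P : Matrix (Fin n) (Fin n) ℂ) (z : Fin n → ℂ) :
    Matrix (Fin n) (Fin n) ℝ →ₗ[ℝ] ℝ where
  toFun A := (star z ⬝ᵥ (Mmat β P A).mulVec z).re
  map_add' A B := by
    rw [Mmat_add, Matrix.add_mulVec, dotProduct_add, Complex.add_re]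
  map_smul' c A := by
    rw [Mmat_smul, Matrix.smul_mulVec, dotProduct_smul, smul_eq_mul, Complex.re_ofReal_mul,
      RingHom.id_apply, smul_eq_mul]

theorem stmt_3 (n : ℕ) (hn : 1 ≤ n) (β : ℂ)
    (L U : Matrix (Fin n) (Fin n) ℝ) (hLU : ∀ i j, L i j ≤ U i j)
    (P : Matrix (Fin n) (Fin n) ℂ) (hP : P.IsHermitian)
    (z : Fin n → ℂ) :
    ∃ V ∈ {A : Matrix (Fin n) (Fin n) ℝ | ∀ i j, A i j = L i j ∨ A i j = U i j},
      ∀ A ∈ {A : Matrix (Fin n) (Fin n) ℝ | ∀ i j, L i j ≤ A i j ∧ A i j ≤ U i j},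
        (star z ⬝ᵥ (Mmat β P A).mulVec z).re ≤ (star z ⬝ᵥ (Mmat β P V).mulVec z).re := by
  exact exists_vertex_forall_le (reFormMmat β P z) L U
end

section
/- (Lemma 2 of Ahn et al. / Lemma 3 of the report.) Let n ≥ 1, β ∈ ℂ, and let L, U be real n×n matrices with L i j ≤ U i j entrywise. Then for any complex n×n Hermitian matrix P, there exists a vertex matrix V ∈ 𝒱 such that for every A ∈ 𝒜, λ_max(M(P, A)) ≤ λ_max(M(P, V)); that is, the value λ̄(P) := sup over A ∈ 𝒜 of the largest eigenvalue of M(P, A) is attained (maximized) at one of the vertex matrices. -/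
open Matrix

/-- The largest eigenvalue of a Hermitian complex matrix (junk value `0` for
non-Hermitian matrices). -/
noncomputable def lamMax {n : ℕ} (N : Matrix (Fin n) (Fin n) ℂ) : ℝ :=
  if h : N.IsHermitian then ⨆ i, h.eigenvalues i else 0

/-- A real linear functional on matrices is bounded on an interval matrix by its value at some
vertex, indexed by the choice of the upper or lower bound in each entry. -/
theorem exists_vertex_ge {n : ℕ} (f : Matrix (Fin n) (Fin n) ℝ →ₗ[ℝ] ℝ)
    (L U A : Matrix (Fin n) (Fin n) ℝ) (hA : ∀ i j, L i j ≤ A i j ∧ A i j ≤ U i j) :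
    ∃ s : Fin n → Fin n → Bool, f A ≤ f (Matrix.of fun i j => if s i j then U i j else L i j) := by
  have key (B : Matrix (Fin n) (Fin n) ℝ) :
      f B = ∑ i, ∑ j, B i j * f (Matrix.single i j 1) := by
    conv_lhs => rw [Matrix.matrix_eq_sum_single B]
    simp only [map_sum]
    refine Finset.sum_congr rfl fun i _ => Finset.sum_congr rfl fun j _ => ?_
    rw [← smul_eq_mul, ← map_smul, Matrix.smul_single, smul_eq_mul, mul_one]
  refine ⟨fun i j => decide (0 ≤ f (Matrix.single i j 1)), ?_⟩
  rw [key A, key (Matrix.of _)]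
  refine Finset.sum_le_sum fun i _ => Finset.sum_le_sum fun j _ => ?_
  by_cases h : 0 ≤ f (Matrix.single i j 1)
  · simpa [h] using mul_le_mul_of_nonneg_right (hA i j).2 h
  · simpa [h] using mul_le_mul_of_nonpos_right (hA i j).1 (not_le.mp h).le

theorem isHermitian_Mmat {n : ℕ} (β : ℂ) {P : Matrix (Fin n) (Fin n) ℂ} (hP : P.IsHermitian)
    (A : Matrix (Fin n) (Fin n) ℝ) : (Mmat β P A).IsHermitian := by
  have hA : (A.map Complex.ofReal)ᴴ = (A.map Complex.ofReal)ᵀ := by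
    ext i j
    simp
  have hA' : ((A.map Complex.ofReal)ᵀ)ᴴ = A.map Complex.ofReal := by
    ext i j
    simp
  simp only [Matrix.IsHermitian, Mmat, conjTranspose_add, conjTranspose_smul, conjTranspose_mul,
    hA, hA', hP.eq, starRingEnd_apply, star_star]
  exact add_comm _ _

/-- The real part of the quadratic form of `Mmat β P A` at `x`, as a real linear function of `A`. -/
noncomputable def quadMmat {n : ℕ} (β : ℂ) (P : Matrix (Fin n) (Fin n) ℂ) (x : Fin n → ℂ) :
    Matrix (Fin n) (Fin n) ℝ →ₗ[ℝ] ℝ where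
  toFun A := (star x ⬝ᵥ Mmat β P A *ᵥ x).re
  map_add' A B := by
    have h : Mmat β P (A + B) = Mmat β P A + Mmat β P B := by
      have hmap : (A + B).map Complex.ofReal = A.map Complex.ofReal + B.map Complex.ofReal := by
        ext i j
        simp
      simp only [Mmat, hmap, mul_add, add_mul, transpose_add, smul_add]
      abel
    rw [h, add_mulVec, dotProduct_add, Complex.add_re]
  map_smul' c A := by
    have h : Mmat β P (c • A) = (c : ℂ) • Mmat β P A := by
      have hmap : (c • A).map Complex.ofReal = (c : ℂ) • A.map Complex.ofReal := by
        ext i j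
        simp
      simp only [Mmat, hmap, Matrix.mul_smul, Matrix.smul_mul, transpose_smul, smul_add]
      rw [smul_comm β, smul_comm (starRingEnd ℂ β)]
    rw [h, smul_mulVec, dotProduct_smul]
    simp

open scoped ComplexOrder in
theorem re_dotProduct_mulVec_le_lamMax {n : ℕ} {N : Matrix (Fin n) (Fin n) ℂ}
    (hN : N.IsHermitian) (x : Fin n → ℂ) :
    (star x ⬝ᵥ N *ᵥ x).re ≤ lamMax N * (star x ⬝ᵥ x).re := by
  have hle (i : Fin n) : hN.eigenvalues i ≤ lamMax N := by
    rw [lamMax, dif_pos hN]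
    exact le_ciSup (Set.finite_range _).bddAbove i
  let W : Matrix (Fin n) (Fin n) ℂ := hN.eigenvectorUnitary
  have hWW : W * Wᴴ = 1 := Unitary.coe_mul_star_self hN.eigenvectorUnitary
  have hspec : N = W * diagonal (fun i => (hN.eigenvalues i : ℂ)) * Wᴴ := hN.spectral_theorem
  have hpsd : ((lamMax N : ℂ) • (1 : Matrix (Fin n) (Fin n) ℂ) - N).PosSemidef := by
    have hd : (diagonal fun i => ((lamMax N - hN.eigenvalues i : ℝ) : ℂ)).PosSemidef :=
      PosSemidef.diagonal fun i => by
        simpa using hle i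
    convert hd.mul_mul_conjTranspose_same W using 1
    have : (diagonal fun i => ((lamMax N - hN.eigenvalues i : ℝ) : ℂ)) =
        (lamMax N : ℂ) • 1 - diagonal fun i => (hN.eigenvalues i : ℂ) := by
      ext i j
      by_cases h : i = j <;> simp [h]
    rw [this, mul_sub, sub_mul, ← hspec, Matrix.mul_smul, Matrix.smul_mul, mul_one, hWW]
  have h := hpsd.re_dotProduct_nonneg x
  simp only [sub_mulVec, smul_mulVec, one_mulVec, dotProduct_sub, dotProduct_smul] at h
  simpa using h

theorem exists_re_dotProduct_mulVec_eq_lamMax {n : ℕ} (hn : 1 ≤ n)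
    {N : Matrix (Fin n) (Fin n) ℂ} (hN : N.IsHermitian) :
    ∃ x : Fin n → ℂ, star x ⬝ᵥ x = 1 ∧ (star x ⬝ᵥ N *ᵥ x).re = lamMax N := by
  have : Nonempty (Fin n) := ⟨⟨0, hn⟩⟩
  obtain ⟨i, hi⟩ := exists_eq_ciSup_of_finite (f := hN.eigenvalues)
  have hnorm : star (hN.eigenvectorBasis i).ofLp ⬝ᵥ (hN.eigenvectorBasis i).ofLp = 1 := by
    have h := inner_self_eq_one_of_norm_eq_one (𝕜 := ℂ) (hN.eigenvectorBasis.norm_eq_one i)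
    rwa [EuclideanSpace.inner_eq_star_dotProduct, dotProduct_comm] at h
  refine ⟨hN.eigenvectorBasis i, hnorm, ?_⟩
  rw [hN.mulVec_eigenvectorBasis, dotProduct_smul, hnorm, lamMax, dif_pos hN, ← hi]
  simp

theorem stmt_5 (n : ℕ) (hn : 1 ≤ n) (β : ℂ)
    (L U : Matrix (Fin n) (Fin n) ℝ) (hLU : ∀ i j, L i j ≤ U i j)
    (P : Matrix (Fin n) (Fin n) ℂ) (hP : P.IsHermitian) :
    ∃ V ∈ {A : Matrix (Fin n) (Fin n) ℝ | ∀ i j, A i j = L i j ∨ A i j = U i j},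
      ∀ A ∈ {A : Matrix (Fin n) (Fin n) ℝ | ∀ i j, L i j ≤ A i j ∧ A i j ≤ U i j},
        lamMax (Mmat β P A) ≤ lamMax (Mmat β P V) := by
  obtain ⟨s, hs⟩ := Finite.exists_max fun s : Fin n → Fin n → Bool =>
    lamMax (Mmat β P (Matrix.of fun i j => if s i j then U i j else L i j))
  refine ⟨Matrix.of fun i j => if s i j then U i j else L i j, fun i j => ?_, fun A hA => ?_⟩
  · cases h : s i j <;> simp [h]
  · obtain ⟨x, hx, hxA⟩ := exists_re_dotProduct_mulVec_eq_lamMax hn (isHermitian_Mmat β hP A)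
    obtain ⟨t, ht⟩ := exists_vertex_ge (quadMmat β P x) L U A hA
    have hV := re_dotProduct_mulVec_le_lamMax (isHermitian_Mmat β hP
      (Matrix.of fun i j => if t i j then U i j else L i j)) x
    rw [hx, Complex.one_re, mul_one] at hV
    exact hxA.ge.trans (ht.trans (hV.trans (hs t)))
end

section
/- (Core 'if' direction of Theorem 2.) Let n ≥ 1, β ∈ ℂ, and let L, U be real n×n matrices with L i j ≤ U i j entrywise. Let P be a complex n×n Hermitian positive-definite matrix such that M(P, V) is negative definite for every vertex matrix V ∈ 𝒱. Then M(P, A) is negative definite for every A ∈ 𝒜. -/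
open Matrix ComplexOrder

theorem Mmat_add_smul {n : ℕ} (β : ℂ) (P : Matrix (Fin n) (Fin n) ℂ)
    (A B : Matrix (Fin n) (Fin n) ℝ) (a b : ℝ) :
    Mmat β P (a • A + b • B) = (a : ℂ) • Mmat β P A + (b : ℂ) • Mmat β P B := by
  have h : (a • A + b • B).map Complex.ofReal =
      (a : ℂ) • A.map Complex.ofReal + (b : ℂ) • B.map Complex.ofReal := by
    ext i j
    simp
  simp only [Mmat, h, Matrix.mul_add, Matrix.add_mul, Matrix.transpose_add,
    Matrix.transpose_smul, Matrix.mul_smul, Matrix.smul_mul]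
  module

theorem convex_setOf_neg_Mmat_posDef {n : ℕ} (β : ℂ) (P : Matrix (Fin n) (Fin n) ℂ) :
    Convex ℝ {A : Matrix (Fin n) (Fin n) ℝ | (-(Mmat β P A)).PosDef} := by
  refine convex_iff_forall_pos.2 fun A hA B hB a b ha hb _ => ?_
  have hA' : ((a : ℂ) • -(Mmat β P A)).PosDef := Matrix.PosDef.smul hA (by exact_mod_cast ha)
  have hB' : ((b : ℂ) • -(Mmat β P B)).PosDef := Matrix.PosDef.smul hB (by exact_mod_cast hb)
  have h := hA'.add hB'
  rwa [smul_neg, smul_neg, ← neg_add, ← Mmat_add_smul] at h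

theorem mem_convexHull_vertices {m n : Type*} [Finite m] [Finite n] {L U A : Matrix m n ℝ}
    (hA : ∀ i j, L i j ≤ A i j ∧ A i j ≤ U i j) :
    A ∈ convexHull ℝ {V : Matrix m n ℝ | ∀ i j, V i j = L i j ∨ V i j = U i j} := by
  have h : {V : Matrix m n ℝ | ∀ i j, V i j = L i j ∨ V i j = U i j} =
      Set.univ.pi fun i => Set.univ.pi fun j => {L i j, U i j} := by
    ext V
    exact ⟨fun hV i _ j _ => hV i j, fun hV i j => hV i trivial j trivial⟩
  rw [h]
  refine mem_convexHull_pi fun i _ => mem_convexHull_pi fun j _ => ?_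
  rw [convexHull_pair, segment_eq_Icc ((hA i j).1.trans (hA i j).2)]
  exact hA i j

theorem stmt_7 (n : ℕ) (hn : 1 ≤ n) (β : ℂ)
    (L U : Matrix (Fin n) (Fin n) ℝ) (hLU : ∀ i j, L i j ≤ U i j)
    (P : Matrix (Fin n) (Fin n) ℂ) (hP : P.PosDef)
    (hV : ∀ V ∈ {A : Matrix (Fin n) (Fin n) ℝ | ∀ i j, A i j = L i j ∨ A i j = U i j},
      (-(Mmat β P V)).PosDef) :
    ∀ A ∈ {A : Matrix (Fin n) (Fin n) ℝ | ∀ i j, L i j ≤ A i j ∧ A i j ≤ U i j},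
      (-(Mmat β P A)).PosDef := by
  intro A hA
  exact convexHull_min hV (convex_setOf_neg_Mmat_posDef β P) (mem_convexHull_vertices hA)
end

section
/- (Theorem 2: exact condition for quadratic stability.) Let n ≥ 1, β ∈ ℂ, and let L, U be real n×n matrices with L i j ≤ U i j entrywise. Then there exists a complex n×n Hermitian positive-definite matrix P such that M(P, A) is negative definite for every A ∈ 𝒜 if and only if there exists a complex n×n Hermitian positive-definite matrix P such that M(P, V) is negative definite for every vertex matrix V ∈ 𝒱. -/
open Matrix ComplexOrder

theorem Mmat_combo {n : ℕ} (β : ℂ) (P : Matrix (Fin n) (Fin n) ℂ)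
    (A B : Matrix (Fin n) (Fin n) ℝ) (a b : ℝ) :
    Mmat β P (a • A + b • B) = a • Mmat β P A + b • Mmat β P B := by
  have h : (a • A + b • B).map Complex.ofReal =
      a • A.map Complex.ofReal + b • B.map Complex.ofReal := by
    ext i j
    simp
  simp only [Mmat, h, Matrix.transpose_add, Matrix.transpose_smul, Matrix.mul_add,
    Matrix.add_mul, Matrix.mul_smul, Matrix.smul_mul, smul_add,
    smul_comm β, smul_comm (starRingEnd ℂ β)]
  abel

theorem convexHull_vertices_pi_pi {m n : Type*} [Finite m] [Finite n] {L U : m → n → ℝ}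
    (hLU : ∀ i j, L i j ≤ U i j) :
    convexHull ℝ {A : m → n → ℝ | ∀ i j, A i j = L i j ∨ A i j = U i j} =
      {A : m → n → ℝ | ∀ i j, L i j ≤ A i j ∧ A i j ≤ U i j} := by
  have h : {A : m → n → ℝ | ∀ i j, A i j = L i j ∨ A i j = U i j} =
      Set.univ.pi fun i => Set.univ.pi fun j => {L i j, U i j} := by
    ext A
    simp
  rw [h]
  ext A
  simp only [convexHull_pi, convexHull_pair, segment_eq_Icc, hLU, Set.mem_univ_pi, Set.mem_Icc,
    Set.mem_ofPred_eq]

/-- An interval matrix set is the convex hull of its vertex set. -/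
theorem convexHull_vertexMatrices {m n : Type*} [Finite m] [Finite n] {L U : Matrix m n ℝ}
    (hLU : ∀ i j, L i j ≤ U i j) :
    convexHull ℝ {A : Matrix m n ℝ | ∀ i j, A i j = L i j ∨ A i j = U i j} =
      {A : Matrix m n ℝ | ∀ i j, L i j ≤ A i j ∧ A i j ≤ U i j} :=
  convexHull_vertices_pi_pi hLU

theorem stmt_8 (n : ℕ) (hn : 1 ≤ n) (β : ℂ)
    (L U : Matrix (Fin n) (Fin n) ℝ) (hLU : ∀ i j, L i j ≤ U i j) :
    (∃ P : Matrix (Fin n) (Fin n) ℂ, P.PosDef ∧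
        ∀ A ∈ {A : Matrix (Fin n) (Fin n) ℝ | ∀ i j, L i j ≤ A i j ∧ A i j ≤ U i j},
          (-(Mmat β P A)).PosDef) ↔
      (∃ P : Matrix (Fin n) (Fin n) ℂ, P.PosDef ∧
        ∀ V ∈ {A : Matrix (Fin n) (Fin n) ℝ | ∀ i j, A i j = L i j ∨ A i j = U i j},
          (-(Mmat β P V)).PosDef) := by
  constructor
  · rintro ⟨P, hP, h⟩
    refine ⟨P, hP, fun V hV => h V ?_⟩
    rw [← convexHull_vertexMatrices hLU]
    exact subset_convexHull ℝ _ hV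
  · rintro ⟨P, hP, h⟩
    refine ⟨P, hP, fun A hA => ?_⟩
    rw [← convexHull_vertexMatrices hLU] at hA
    exact convexHull_min h (convex_setOf_neg_Mmat_posDef β P) hA
end
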